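/- Let A₂ be the level-2 Schreier adjacency matrix of the Grigorchuk group, i.e., the 4×4 integer matrix indexed by binary words of length 2 with A₂(u,v) = #{s ∈ {a,b,c,d} : s(u) = v}; explicitly, in the vertex order (00, 01, 10, 11), A₂ has rows [[1,2,1,0],[2,1,0,1],[1,0,3,0],[0,1,0,3]]. Then, as an identity of polynomials in t over ℤ, det(I₄ − t·A₂ + 3t²·I₄) = (t−1)(3t−1)(3t²−2t+1)(9t⁴−6t³+2t²−2t+1). (This is the determinant factor in the Ihara–Bass formula for the Ihara zeta function of the level-2 Schreier graph Γ₂ of the Grigorchuk group, computed via the Artin L-functions of the ℤ/2ℤ-Galois covering Γ₂|Γ₁.) -/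

import Mathlib

/-- The generator `a` of the Grigorchuk group: `a(0w)=1w`, `a(1w)=0w`. -/
def grigA : List (Fin 2) → List (Fin 2)
  | [] => []
  | x :: w => (1 - x) :: w

mutual
/-- The generator `b`: `b(0w)=0·a(w)`, `b(1w)=1·c(w)`. -/
def grigB : List (Fin 2) → List (Fin 2)
  | [] => []
  | x :: w => if x = 0 then x :: grigA w else x :: grigC w
/-- The generator `c`: `c(0w)=0·a(w)`, `c(1w)=1·d(w)`. -/
def grigC : List (Fin 2) → List (Fin 2)
  | [] => []
  | x :: w => if x = 0 then x :: grigA w else x :: grigD w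
/-- The generator `d`: `d(0w)=0·w`, `d(1w)=1·b(w)`. -/
def grigD : List (Fin 2) → List (Fin 2)
  | [] => []
  | x :: w => if x = 0 then x :: w else x :: grigB w
end

open Polynomial

/-- The generating set `{a, b, c, d}` of the Grigorchuk group. -/
def grigGens : List (List (Fin 2) → List (Fin 2)) := [grigA, grigB, grigC, grigD]

/-- The level-2 Schreier adjacency matrix `A₂` of the Grigorchuk group, indexed by
binary words `u₁u₂` of length 2: `A₂(u,v) = #{s ∈ {a,b,c,d} : s(u) = v}`. -/
def grigAdj2 : Matrix (Fin 2 × Fin 2) (Fin 2 × Fin 2) ℤ :=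
  fun u v => (grigGens.countP (fun s => decide (s [u.1, u.2] = [v.1, v.2])) : ℤ)

/-- The encoding of binary words of length 2 in the vertex order `(00, 01, 10, 11)`. -/
def enc2 (u : Fin 2 × Fin 2) : Fin 4 :=
  ⟨2 * (u.1 : ℕ) + (u.2 : ℕ), by have := u.1.isLt; have := u.2.isLt; omega⟩

theorem grigAdj2_apply (u v : Fin 2 × Fin 2) :
    grigAdj2 u v
      = (!![1,2,1,0; 2,1,0,1; 1,0,3,0; 0,1,0,3] : Matrix (Fin 4) (Fin 4) ℤ)
          (enc2 u) (enc2 v) := by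
  obtain ⟨a, b⟩ := u
  obtain ⟨c, d⟩ := v
  fin_cases a <;> fin_cases b <;> fin_cases c <;> fin_cases d <;>
    simp [grigAdj2, grigGens, grigA, grigB, grigC, grigD, enc2]

/-- In the vertex order `(00, 01, 10, 11)`, the level-2 Schreier adjacency matrix of
the Grigorchuk group has rows `[[1,2,1,0],[2,1,0,1],[1,0,3,0],[0,1,0,3]]`, and the
determinant factor in the Ihara–Bass formula for the Ihara zeta function of `Γ₂` is
`det(I₄ − t·A₂ + 3t²·I₄) = (t−1)(3t−1)(3t²−2t+1)(9t⁴−6t³+2t²−2t+1)`. -/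
theorem grigorchuk_level2_ihara_det :
    (∀ u v : Fin 2 × Fin 2,
        grigAdj2 u v
          = (!![1,2,1,0; 2,1,0,1; 1,0,3,0; 0,1,0,3] : Matrix (Fin 4) (Fin 4) ℤ)
              (enc2 u) (enc2 v)) ∧
    Matrix.det
      ((1 : Matrix (Fin 2 × Fin 2) (Fin 2 × Fin 2) (Polynomial ℤ))
        - (X : Polynomial ℤ) • (grigAdj2.map C)
        + (3 * X ^ 2 : Polynomial ℤ) •
            (1 : Matrix (Fin 2 × Fin 2) (Fin 2 × Fin 2) (Polynomial ℤ)))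
      = (X - 1) * (3 * X - 1) * (3 * X ^ 2 - 2 * X + 1)
        * (9 * X ^ 4 - 6 * X ^ 3 + 2 * X ^ 2 - 2 * X + 1) := by
  refine ⟨grigAdj2_apply, ?_⟩
  rw [← Matrix.det_submatrix_equiv_self (finProdFinEquiv (m := 2) (n := 2)).symm]
  trans Matrix.det !![1 - X + 3 * X ^ 2, -2 * X, -X, 0;
      -2 * X, 1 - X + 3 * X ^ 2, 0, -X;
      -X, 0, 1 - 3 * X + 3 * X ^ 2, 0;
      0, -X, 0, (1 - 3 * X + 3 * X ^ 2 : ℤ[X])]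
  · congr 1
    ext1 i j
    fin_cases i <;> fin_cases j <;>
      simp [grigAdj2_apply, enc2, finProdFinEquiv, Fin.divNat, Fin.modNat] <;>
      ring
  · simp [Matrix.det_succ_row_zero, Fin.sum_univ_succ, Fin.succAbove]
    ring
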